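/- Let f(k) denote the maximum chromatic number of a graph whose edge set can be partitioned into at most k complete bipartite graphs (with f(0)=1). Then f(k+1) ≤ f(k) + f(⌊k/4⌋) for all k ≥ 0. -/

import Mathlib

/-- The edge set of the complete bipartite graph with parts `A` and `B`. -/
def bicliqueEdges {V : Type*} (A B : Set V) : Set (Sym2 V) :=
  {e | ∃ a ∈ A, ∃ b ∈ B, e = s(a, b)}

/-- `G`'s edge set can be partitioned into at most `k` complete bipartite graphs. -/
def HasBicliquePartition {V : Type*} (G : SimpleGraph V) (k : ℕ) : Prop :=
  ∃ A B : Fin k → Set V,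
    (∀ i, Disjoint (A i) (B i)) ∧
    (Set.univ : Set (Fin k)).PairwiseDisjoint (fun i => bicliqueEdges (A i) (B i)) ∧
    (⋃ i, bicliqueEdges (A i) (B i)) = G.edgeSet

/-- `f k` is the maximum chromatic number of a (finite) graph whose edge set can be
partitioned into at most `k` complete bipartite graphs. -/
noncomputable def f (k : ℕ) : ℕ :=
  sSup {n : ℕ | ∃ (V : Type) (_ : Fintype V) (G : SimpleGraph V),
    HasBicliquePartition G k ∧ G.chromaticNumber = (n : ℕ∞)}

theorem bp_iff_adj {V : Type} {G : SimpleGraph V} {k : ℕ} {A B : Fin k → Set V}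
    (h : (⋃ i, bicliqueEdges (A i) (B i)) = G.edgeSet) (u v : V) :
    G.Adj u v ↔ ∃ i, (u ∈ A i ∧ v ∈ B i) ∨ (v ∈ A i ∧ u ∈ B i) := by
  rw [← SimpleGraph.mem_edgeSet, ← h]
  simp only [Set.mem_iUnion, bicliqueEdges, Set.mem_ofPred_eq, Sym2.eq_iff]
  constructor
  · rintro ⟨i, a, ha, b, hb, ⟨rfl, rfl⟩ | ⟨rfl, rfl⟩⟩
    · exact ⟨i, Or.inl ⟨ha, hb⟩⟩
    · exact ⟨i, Or.inr ⟨ha, hb⟩⟩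
  · rintro ⟨i, ⟨ha, hb⟩ | ⟨ha, hb⟩⟩
    · exact ⟨i, u, ha, v, hb, Or.inl ⟨rfl, rfl⟩⟩
    · exact ⟨i, v, ha, u, hb, Or.inr ⟨rfl, rfl⟩⟩

theorem bp_uniq {V : Type} {k : ℕ} {A B : Fin k → Set V}
    (h : (Set.univ : Set (Fin k)).PairwiseDisjoint (fun i => bicliqueEdges (A i) (B i)))
    {i j : Fin k} (hij : i ≠ j) {a b : V} (ha : a ∈ A i) (hb : b ∈ B i) :
    ¬ (a ∈ A j ∧ b ∈ B j) ∧ ¬ (b ∈ A j ∧ a ∈ B j) := by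
  have hd : s(a, b) ∉ bicliqueEdges (A j) (B j) :=
    Set.disjoint_left.1 (h (Set.mem_univ i) (Set.mem_univ j) hij) ⟨a, ha, b, hb, rfl⟩
  exact ⟨fun ⟨h1, h2⟩ => hd ⟨a, h1, b, h2, rfl⟩,
    fun ⟨h1, h2⟩ => hd ⟨b, h1, a, h2, Sym2.eq_swap⟩⟩

theorem bp_colorable_pow {V : Type} {G : SimpleGraph V} {k : ℕ}
    (h : HasBicliquePartition G k) : G.Colorable (2 ^ k) := by
  classical
  obtain ⟨A, B, hd, _, hU⟩ := h
  have c : G.Coloring (Fin k → Bool) := SimpleGraph.Coloring.mk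
    (fun v i => decide (v ∈ A i)) (by
      intro u v huv heq
      obtain ⟨i, ⟨h1, h2⟩ | ⟨h1, h2⟩⟩ := (bp_iff_adj hU u v).1 huv
      · have := congrFun heq i
        simp [h1] at this
        exact Set.disjoint_left.1 (hd i) this h2
      · have := congrFun heq i
        simp [h1] at this
        exact Set.disjoint_left.1 (hd i) this h2)
  simpa using c.colorable

theorem bp_colorable {V : Type} [Fintype V] {G : SimpleGraph V} {k : ℕ}
    (h : HasBicliquePartition G k) : G.Colorable (f k) := by
  have hc := bp_colorable_pow h
  obtain ⟨n, hn⟩ := ENat.ne_top_iff_exists.1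
    (SimpleGraph.chromaticNumber_ne_top_iff_exists.2 ⟨_, hc⟩)
  rw [← SimpleGraph.chromaticNumber_le_iff_colorable, ← hn]
  refine Nat.cast_le.2 (le_csSup ⟨2 ^ k, ?_⟩ ⟨V, inferInstance, G, h, hn.symm⟩)
  rintro m ⟨W, _, H, hH, hm⟩
  have := (bp_colorable_pow hH).chromaticNumber_le
  rw [hm] at this
  exact_mod_cast this

theorem bp_induce {V : Type} {G : SimpleGraph V} {n m : ℕ} {A B : Fin n → Set V}
    (hd : ∀ i, Disjoint (A i) (B i))
    (hp : (Set.univ : Set (Fin n)).PairwiseDisjoint (fun i => bicliqueEdges (A i) (B i)))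
    (hU : (⋃ i, bicliqueEdges (A i) (B i)) = G.edgeSet)
    (S : Set V) (J : Finset (Fin n)) (hJ : J.card ≤ m)
    (hS : ∀ j, ∀ a ∈ A j, ∀ b ∈ B j, a ∈ S → b ∈ S → j ∈ J) :
    HasBicliquePartition (G.induce S) m := by
  classical
  obtain ⟨e⟩ : Nonempty (J ↪ Fin m) :=
    Function.Embedding.nonempty_of_card_le (by simpa using hJ)
  refine ⟨fun i => {v | ∃ j : J, e j = i ∧ (v : V) ∈ A j},
    fun i => {v | ∃ j : J, e j = i ∧ (v : V) ∈ B j}, ?_, ?_, ?_⟩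
  · intro i
    rw [Set.disjoint_left]
    rintro v ⟨j, rfl, hj⟩ ⟨j', hj', hb⟩
    obtain rfl := e.injective hj'
    exact Set.disjoint_left.1 (hd _) hj hb
  · intro i _ i' _ hii
    change Disjoint _ _
    rw [Set.disjoint_left]
    rintro _ ⟨a, ⟨j, rfl, ha⟩, b, ⟨j2, hj2, hb⟩, rfl⟩ ⟨c, ⟨j3, rfl, hc⟩, d, ⟨j4, hj4, hd'⟩, h⟩
    obtain rfl := e.injective hj2
    obtain rfl := e.injective hj4
    have hne : (j2 : Fin n) ≠ j4 := by
      intro h; exact hii (by rw [Subtype.ext h])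
    have := bp_uniq hp hne ha hb
    rcases Sym2.eq_iff.1 h with ⟨rfl, rfl⟩ | ⟨rfl, rfl⟩
    · exact this.1 ⟨hc, hd'⟩
    · exact this.2 ⟨hc, hd'⟩
  · ext x
    induction x using Sym2.ind with
    | _ u v =>
    rw [SimpleGraph.mem_edgeSet, SimpleGraph.comap_adj]
    refine Iff.trans ?_ (bp_iff_adj hU _ _).symm
    simp only [Set.mem_iUnion]
    constructor
    · rintro ⟨i, a, ⟨j, rfl, ha⟩, b, ⟨j2, hj2, hb⟩, h⟩
      obtain rfl := e.injective hj2
      rcases Sym2.eq_iff.1 h with ⟨rfl, rfl⟩ | ⟨rfl, rfl⟩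
      · exact ⟨j2, Or.inl ⟨ha, hb⟩⟩
      · exact ⟨j2, Or.inr ⟨ha, hb⟩⟩
    · rintro ⟨j, ⟨ha, hb⟩ | ⟨ha, hb⟩⟩
      · have hj := hS j _ ha _ hb u.2 v.2
        exact ⟨e ⟨j, hj⟩, u, ⟨_, rfl, ha⟩, v, ⟨_, rfl, hb⟩, rfl⟩
      · have hj := hS j _ ha _ hb v.2 u.2
        exact ⟨e ⟨j, hj⟩, v, ⟨_, rfl, ha⟩, u, ⟨_, rfl, hb⟩, Sym2.eq_swap⟩

theorem colorable_split {V : Type} {G : SimpleGraph V} (S : Set V) {a b : ℕ}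
    (h1 : (G.induce S).Colorable a) (h2 : (G.induce Sᶜ).Colorable b) :
    G.Colorable (a + b) := by
  classical
  obtain ⟨c1⟩ := h1
  obtain ⟨c2⟩ := h2
  have c : G.Coloring (Fin a ⊕ Fin b) := SimpleGraph.Coloring.mk
    (fun v => if h : v ∈ S then Sum.inl (c1 ⟨v, h⟩) else Sum.inr (c2 ⟨v, h⟩)) (by
      intro u v huv
      by_cases hu : u ∈ S <;> by_cases hv : v ∈ S <;> simp only [hu, hv, dif_pos, dif_neg,
        not_false_eq_true, ne_eq, reduceCtorEq, Sum.inl.injEq, Sum.inr.injEq]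
      · exact c1.valid (by simpa using huv)
      · exact c2.valid (by simpa using huv))
  simpa using c.colorable

/-- Counting: some side is crossed by at most `k / 4` bicliques. -/
theorem exists_light_side {V : Type} {k : ℕ} {A B : Fin (k + 1) → Set V}
    (hd : ∀ i, Disjoint (A i) (B i))
    (hp : (Set.univ : Set (Fin (k + 1))).PairwiseDisjoint
      (fun i => bicliqueEdges (A i) (B i))) :
    ∃ i, ∃ S : Set V, (S = A i ∨ S = B i) ∧ ∃ J : Finset (Fin (k + 1)), J.card ≤ k / 4 ∧
      ∀ j, ∀ a ∈ A j, ∀ b ∈ B j, a ∈ S → b ∈ S → j ∈ J := by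
  classical
  let P : Set V → Fin (k + 1) → Prop := fun S j => ∃ a ∈ A j, ∃ b ∈ B j, a ∈ S ∧ b ∈ S
  let c : Fin (k + 1) → Fin (k + 1) → ℕ := fun i j =>
    (if P (A i) j then 1 else 0) + (if P (B i) j then 1 else 0)
  by_contra hcon
  have key : ∀ i, ∀ S : Set V, (S = A i ∨ S = B i) →
      k + 1 ≤ 4 * ∑ j, (if P S j then 1 else 0) := by
    intro i S hS
    by_contra hlt
    refine hcon ⟨i, S, hS, Finset.univ.filter (P S), ?_, ?_⟩
    · have hc : (Finset.univ.filter (P S)).card = ∑ j, (if P S j then 1 else 0) :=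
        Finset.card_filter _ _
      omega
    · intro j a ha b hb h1 h2
      simp only [Finset.mem_filter, Finset.mem_univ, true_and]
      exact ⟨a, ha, b, hb, h1, h2⟩
  have hlow : ∀ i, k + 1 ≤ 2 * ∑ j, c i j := by
    intro i
    have h1 := key i (A i) (Or.inl rfl)
    have h2 := key i (B i) (Or.inr rfl)
    simp only [c, Finset.sum_add_distrib]
    omega
  have hup : ∀ i j, c i j + c j i ≤ if i = j then 0 else 1 := by
    intro i j
    split_ifs with hij
    · subst hij
      have h1 : ¬ P (A i) i := by
        rintro ⟨a, ha, b, hb, h1, h2⟩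
        exact Set.disjoint_left.1 (hd i) h2 hb
      have h2 : ¬ P (B i) i := by
        rintro ⟨a, ha, b, hb, h1, h2⟩
        exact Set.disjoint_left.1 (hd i) ha h1
      simp [c, h1, h2]
    · have hu : ∀ a b, a ∈ A i → b ∈ B i →
          ¬ (a ∈ A j ∧ b ∈ B j) ∧ ¬ (b ∈ A j ∧ a ∈ B j) :=
        fun a b ha hb => bp_uniq hp hij ha hb
      have e1 : ¬ (P (A i) j ∧ P (B i) j) := by
        rintro ⟨⟨a, ha, b, hb, h1, h2⟩, ⟨a', ha', b', hb', h1', h2'⟩⟩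
        exact (hu a b' h1 h2').1 ⟨ha, hb'⟩
      have e2 : ¬ (P (A j) i ∧ P (B j) i) := by
        rintro ⟨⟨a, ha, b, hb, h1, h2⟩, ⟨a', ha', b', hb', h1', h2'⟩⟩
        exact (hu a b' ha hb').1 ⟨h1, h2'⟩
      have e3 : ¬ (P (A i) j ∧ P (A j) i) := by
        rintro ⟨⟨a, ha, b, hb, h1, h2⟩, ⟨a', ha', b', hb', h1', h2'⟩⟩
        exact (hu b b' h2 hb').2 ⟨h2', hb⟩
      have e4 : ¬ (P (A i) j ∧ P (B j) i) := by
        rintro ⟨⟨a, ha, b, hb, h1, h2⟩, ⟨a', ha', b', hb', h1', h2'⟩⟩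
        exact (hu a b' h1 hb').1 ⟨ha, h2'⟩
      have e5 : ¬ (P (B i) j ∧ P (A j) i) := by
        rintro ⟨⟨a, ha, b, hb, h1, h2⟩, ⟨a', ha', b', hb', h1', h2'⟩⟩
        exact (hu a' b ha' h2).1 ⟨h1', hb⟩
      have e6 : ¬ (P (B i) j ∧ P (B j) i) := by
        rintro ⟨⟨a, ha, b, hb, h1, h2⟩, ⟨a', ha', b', hb', h1', h2'⟩⟩
        exact (hu a' a ha' h1).2 ⟨ha, h1'⟩
      simp only [c]
      clear_value P
      by_cases q1 : P (A i) j <;> by_cases q2 : P (B i) j <;> by_cases q3 : P (A j) i <;>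
        by_cases q4 : P (B j) i <;> simp_all
  have hsum : ∑ i, ∑ j, (c i j + c j i) ≤ ∑ i : Fin (k + 1), k := by
    refine Finset.sum_le_sum fun i _ => ?_
    refine (Finset.sum_le_sum fun j _ => hup i j).trans ?_
    have : ∑ j : Fin (k + 1), ((if i = j then 0 else 1) + (if i = j then 1 else 0)) = k + 1 := by
      rw [Finset.sum_congr rfl (g := fun _ => 1) (by intro j _; split_ifs <;> rfl)]
      simp
    rw [Finset.sum_add_distrib, Finset.sum_ite_eq] at this
    simp only [Finset.mem_univ, if_true] at this
    omega
  have hsw : ∑ i, ∑ j, (c i j + c j i) = 2 * ∑ i, ∑ j, c i j := by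
    simp only [Finset.sum_add_distrib]
    rw [Finset.sum_comm (f := fun i j => c j i)]
    ring
  have hl := Finset.sum_le_sum (fun i (_ : i ∈ Finset.univ) => hlow i)
  rw [← Finset.mul_sum] at hl
  rw [hsw] at hsum
  have := hl.trans hsum
  simp only [Finset.sum_const, Finset.card_univ, Fintype.card_fin, smul_eq_mul] at this
  nlinarith

theorem bp_step {V : Type} [Fintype V] {G : SimpleGraph V} {k : ℕ}
    (h : HasBicliquePartition G (k + 1)) : G.Colorable (f k + f (k / 4)) := by
  classical
  obtain ⟨A, B, hd, hp, hU⟩ := h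
  obtain ⟨i, S, hS, J, hJ, hJS⟩ := exists_light_side hd hp
  have h1 : HasBicliquePartition (G.induce S) (k / 4) := bp_induce hd hp hU S J hJ hJS
  have h2 : HasBicliquePartition (G.induce Sᶜ) k := by
    refine bp_induce hd hp hU Sᶜ (Finset.univ.erase i) (by simp) ?_
    intro j a ha b hb haS hbS
    simp only [Finset.mem_erase, Finset.mem_univ, and_true]
    rintro rfl
    rcases hS with rfl | rfl
    · exact haS ha
    · exact hbS hb
  have : Fintype S := Fintype.ofFinite _
  have : Fintype (Sᶜ : Set V) := Fintype.ofFinite _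
  rw [add_comm]
  exact colorable_split S (bp_colorable h1) (bp_colorable h2)

/-- The recursive bound `f(k+1) ≤ f(k) + f(⌊k/4⌋)`. -/
theorem stmt_7 (k : ℕ) : f (k + 1) ≤ f k + f (k / 4) := by
  refine csSup_le' ?_
  rintro n ⟨V, _, G, hG, hn⟩
  have := (bp_step hG).chromaticNumber_le
  rw [hn] at this
  exact_mod_cast this
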